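/- Let λ⁺, λ⁻, μ⁺, μ⁻ ∈ ℝ with μ⁺(λ⁺ + 2μ⁺) ≠ 0 and μ⁻(λ⁻ + 2μ⁻) ≠ 0, let n̄ = (n̄₁, n̄₂) ∈ ℝ² be a unit vector, and set M̄⁻ = N(λ⁺,μ⁺,n̄)⁻¹·N(λ⁻,μ⁻,n̄) and M̄⁺ = N(λ⁻,μ⁻,n̄)⁻¹·N(λ⁺,μ⁺,n̄). Then the vectors α₁ = (−n̄₂, 0, n̄₁, 0)ᵀ and α₂ = (0, −n̄₂, 0, n̄₁)ᵀ satisfy (M̄^s)ᵀ·αᵢ = αᵢ for each s ∈ {+, −} and i ∈ {1, 2}; that is, α₁ and α₂ are eigenvectors of (M̄^s)ᵀ with eigenvalue 1. -/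

import Mathlib

open Matrix

noncomputable section

/-- The 4×4 matrix `N(λ,μ,n)` associated with the elasticity interface jump conditions. -/
def Nmat (lam mu n1 n2 : ℝ) : Matrix (Fin 4) (Fin 4) ℝ :=
  !![(lam + 2*mu)*n1, mu*n2, mu*n2, lam*n1;
     lam*n2, mu*n1, mu*n1, (lam + 2*mu)*n2;
     -n2, 0, n1, 0;
     0, -n2, 0, n1]

theorem det_Nmat (lam mu n1 n2 : ℝ) :
    (Nmat lam mu n1 n2).det = mu * (lam + 2*mu) * (n1^2 + n2^2)^2 := by
  simp [Nmat, det_succ_row_zero, Fin.sum_univ_succ, Fin.succAbove]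
  ring

/-- If two matrices share a row and the first is invertible, then that row is fixed by
`(A⁻¹ * B)ᵀ`. -/
theorem transpose_inv_mul_mulVec_row {m R : Type*} [Fintype m] [DecidableEq m] [CommRing R]
    {A B : Matrix m m R} (hA : IsUnit A.det) {i : m} (hAB : A.row i = B.row i) :
    (A⁻¹ * B)ᵀ *ᵥ A.row i = A.row i := by
  have hrow : A.row i ᵥ* A⁻¹ = Pi.single i 1 := by
    rw [← single_one_vecMul, vecMul_vecMul, mul_nonsing_inv A hA, vecMul_one]
  rw [mulVec_transpose, ← vecMul_vecMul, hrow, single_one_vecMul, hAB]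

theorem isUnit_det_Nmat {lam mu n1 n2 : ℝ} (h : mu * (lam + 2*mu) ≠ 0)
    (hn : n1^2 + n2^2 = 1) : IsUnit (Nmat lam mu n1 n2).det := by
  simpa only [det_Nmat, hn, one_pow, mul_one, isUnit_iff_ne_zero] using h

/-- the vectors `α₁ = (−n̄₂,0,n̄₁,0)ᵀ` and `α₂ = (0,−n̄₂,0,n̄₁)ᵀ` are eigenvectors
of `(M̄^±)ᵀ` with eigenvalue `1`, where `M̄⁻ = (N⁺)⁻¹N⁻` and `M̄⁺ = (N⁻)⁻¹N⁺`. -/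
theorem eigenvectors_of_Mbar_transpose (lp mp lm mm n1 n2 : ℝ)
    (hp : mp * (lp + 2*mp) ≠ 0) (hm : mm * (lm + 2*mm) ≠ 0)
    (hn : n1^2 + n2^2 = 1) :
    let Mm : Matrix (Fin 4) (Fin 4) ℝ := (Nmat lp mp n1 n2)⁻¹ * Nmat lm mm n1 n2
    let Mp : Matrix (Fin 4) (Fin 4) ℝ := (Nmat lm mm n1 n2)⁻¹ * Nmat lp mp n1 n2
    let a1 : Fin 4 → ℝ := ![-n2, 0, n1, 0]
    let a2 : Fin 4 → ℝ := ![0, -n2, 0, n1]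
    Mmᵀ.mulVec a1 = a1 ∧ Mmᵀ.mulVec a2 = a2 ∧ Mpᵀ.mulVec a1 = a1 ∧ Mpᵀ.mulVec a2 = a2 := by
  have up := isUnit_det_Nmat hp hn
  have um := isUnit_det_Nmat hm hn
  exact ⟨transpose_inv_mul_mulVec_row (i := 2) up rfl, transpose_inv_mul_mulVec_row (i := 3) up rfl,
    transpose_inv_mul_mulVec_row (i := 2) um rfl, transpose_inv_mul_mulVec_row (i := 3) um rfl⟩
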